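/- Let {∃,⊓} ⊆ O ⊆ {∀,∃,≥,−,⊓,⊔,⊤,⊥,¬}. (1) If O ⊆ {∃,−,⊓,⊔,⊤,⊥} or O ⊆ {∀,∃,⊔,⊓} or O ⊆ {∀,∃,≥,⊓,⊤}, then L(O) admits finite characterisations. (2) Otherwise, if it is not the case that {≥,−,⊓} ⊆ O ⊆ {∃,≥,−,⊓,⊤}, then L(O) does not admit finite characterisations. -/

import Mathlib

namespace DL

/-! ### Syntax of ALCQI concepts -/

/-- Roles: role names (indexed by ℕ) and inverse roles. -/
inductive Role where
  | name : ℕ → Role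
  | inv  : ℕ → Role
deriving DecidableEq

/-- ALCQI concept expressions. -/
inductive Concept where
  | atom : ℕ → Concept
  | top  : Concept
  | bot  : Concept
  | and  : Concept → Concept → Concept
  | or   : Concept → Concept → Concept
  | neg  : Concept → Concept
  | ex   : Role → Concept → Concept
  | all  : Role → Concept → Concept
  | atLeast : ℕ → Role → Concept → Concept
deriving DecidableEq

/-- The operators/constructors that a concept language may use. -/
inductive Op where
  | all | ex | ge | inv | and | or | top | bot | neg
deriving DecidableEq

/-! ### Interpretations and semantics -/

/-- An interpretation: a nonempty domain, interpretations of concept names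
and of role names. -/
structure Interp where
  Δ : Type
  dom_nonempty : Nonempty Δ
  atom : ℕ → Set Δ
  rel : ℕ → Δ → Δ → Prop

def Role.sem (I : Interp) : Role → (I.Δ → I.Δ → Prop)
  | .name R => I.rel R
  | .inv R  => fun d e => I.rel R e d

def Concept.sem (I : Interp) : Concept → Set I.Δ
  | .atom A => I.atom A
  | .top => Set.univ
  | .bot => ∅
  | .and C D => C.sem I ∩ D.sem I
  | .or C D => C.sem I ∪ D.sem I
  | .neg C => (C.sem I)ᶜ
  | .ex S C => {d | ∃ e, S.sem I d e ∧ e ∈ C.sem I}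
  | .all S C => {d | ∀ e, S.sem I d e → e ∈ C.sem I}
  | .atLeast k S C => {d | ∃ s : Finset I.Δ, s.card = k ∧ ∀ e ∈ s, S.sem I d e ∧ e ∈ C.sem I}

/-! ### Concept languages L(Os)[SC, SR] -/

def Role.inSig (Os : Finset Op) (SR : Finset ℕ) : Role → Prop
  | .name R => R ∈ SR
  | .inv R  => Op.inv ∈ Os ∧ R ∈ SR

/-- Membership of a concept in the language `L(Os)[SC, SR]`. -/
def Concept.inLang (Os : Finset Op) (SC SR : Finset ℕ) : Concept → Prop
  | .atom A => A ∈ SC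
  | .top => Op.top ∈ Os
  | .bot => Op.bot ∈ Os
  | .and C D => Op.and ∈ Os ∧ C.inLang Os SC SR ∧ D.inLang Os SC SR
  | .or C D => Op.or ∈ Os ∧ C.inLang Os SC SR ∧ D.inLang Os SC SR
  | .neg C => Op.neg ∈ Os ∧ C.inLang Os SC SR
  | .ex S C => Op.ex ∈ Os ∧ S.inSig Os SR ∧ C.inLang Os SC SR
  | .all S C => Op.all ∈ Os ∧ S.inSig Os SR ∧ C.inLang Os SC SR
  | .atLeast k S C => Op.ge ∈ Os ∧ 1 ≤ k ∧ S.inSig Os SR ∧ C.inLang Os SC SR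

/-! ### DL-Lite ontologies -/

/-- Basic concepts: concept names, ∃R and ∃R⁻. -/
inductive Basic where
  | atom : ℕ → Basic
  | ex : Role → Basic
deriving DecidableEq

def Basic.sem (I : Interp) : Basic → Set I.Δ
  | .atom A => I.atom A
  | .ex S => {d | ∃ e, S.sem I d e}

/-- A DL-Lite concept inclusion `B ⊑ C` where `C` is a basic concept
(`negated = false`) or a negated basic concept (`negated = true`). -/
structure CI where
  lhs : Basic
  rhs : Basic
  negated : Bool
deriving DecidableEq

def CI.sat (I : Interp) (ci : CI) : Prop :=
  if ci.negated then ci.lhs.sem I ⊆ (ci.rhs.sem I)ᶜ else ci.lhs.sem I ⊆ ci.rhs.sem I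

/-- A DL-Lite ontology: a finite set (list) of concept inclusions. -/
abbrev Ontology := List CI

def Interp.satO (I : Interp) (Ont : Ontology) : Prop := ∀ ci ∈ Ont, ci.sat I

/-! ### Pointed interpretations, examples, characterisations -/

structure PInterp where
  I : Interp
  pt : I.Δ

/-- A pointed interpretation is finite if its domain is finite. -/
def PInterp.finite (P : PInterp) : Prop := Finite P.I.Δ

/-- `C` fits a collection `(Epos, Eneg)` of labelled examples. -/
def Fits (C : Concept) (Epos Eneg : List PInterp) : Prop :=
  (∀ e ∈ Epos, e.pt ∈ C.sem e.I) ∧ (∀ e ∈ Eneg, e.pt ∉ C.sem e.I)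

/-- Equivalence of concepts. -/
def CEquiv (C D : Concept) : Prop := ∀ I : Interp, C.sem I = D.sem I

/-- Equivalence of concepts relative to an ontology. -/
def CEquivO (Ont : Ontology) (C D : Concept) : Prop :=
  ∀ I : Interp, I.satO Ont → C.sem I = D.sem I

/-- `⊨ C ⊑ D`. -/
def Subsumes (C D : Concept) : Prop := ∀ I : Interp, C.sem I ⊆ D.sem I

/-- `Ont ⊨ C ⊑ D`. -/
def SubsumesO (Ont : Ontology) (C D : Concept) : Prop :=
  ∀ I : Interp, I.satO Ont → C.sem I ⊆ D.sem I

/-- `(Epos, Eneg)` is a finite characterisation of `C` w.r.t. the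
concept language (predicate) `L`: all examples are finite, `C` fits,
and every fitting concept of `L` is equivalent to `C`. -/
def FinChar (L : Concept → Prop) (C : Concept) (Epos Eneg : List PInterp) : Prop :=
  (∀ e ∈ Epos ++ Eneg, e.finite) ∧
  Fits C Epos Eneg ∧
  ∀ D, L D → Fits D Epos Eneg → CEquiv C D

/-- Finite characterisation of `C` w.r.t. `L` under an ontology `Ont`:
all examples are finite and satisfy `Ont`, `C` fits, and every fitting
concept of `L` is equivalent to `C` relative to `Ont`. -/
def FinCharO (Ont : Ontology) (L : Concept → Prop) (C : Concept)
    (Epos Eneg : List PInterp) : Prop :=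
  (∀ e ∈ Epos ++ Eneg, e.finite ∧ e.I.satO Ont) ∧
  Fits C Epos Eneg ∧
  ∀ D, L D → Fits D Epos Eneg → CEquivO Ont C D

/-- `L(Os)` admits finite characterisations. -/
def AdmitsFinChar (Os : Finset Op) : Prop :=
  ∀ SC SR : Finset ℕ, ∀ C : Concept, C.inLang Os SC SR →
    ∃ Epos Eneg : List PInterp, FinChar (Concept.inLang Os SC SR) C Epos Eneg

/-- `L(Os)` admits finite characterisations under the ontology `Ont`. -/
def AdmitsFinCharO (Os : Finset Op) (Ont : Ontology) : Prop :=
  ∀ SC SR : Finset ℕ, ∀ C : Concept, C.inLang Os SC SR →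
    ∃ Epos Eneg : List PInterp, FinCharO Ont (Concept.inLang Os SC SR) C Epos Eneg

/-! ### Size, role depth, number restrictions -/

/-- Number of symbols of a concept expression (numbers in binary). -/
def Concept.size : Concept → ℕ
  | .atom _ => 1
  | .top => 1
  | .bot => 1
  | .and C D => C.size + D.size + 1
  | .or C D => C.size + D.size + 1
  | .neg C => C.size + 1
  | .ex _ C => C.size + 2
  | .all _ C => C.size + 2
  | .atLeast k _ C => C.size + 2 + Nat.size k

/-- Role depth of a concept. -/
def Concept.dp : Concept → ℕ
  | .atom _ => 0
  | .top => 0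
  | .bot => 0
  | .and C D => max C.dp D.dp
  | .or C D => max C.dp D.dp
  | .neg C => C.dp
  | .ex _ C => C.dp + 1
  | .all _ C => C.dp + 1
  | .atLeast _ _ C => C.dp + 1

/-- The largest number occurring in a number restriction of `C` (0 if none). -/
def Concept.nr : Concept → ℕ
  | .atom _ => 0
  | .top => 0
  | .bot => 0
  | .and C D => max C.nr D.nr
  | .or C D => max C.nr D.nr
  | .neg C => C.nr
  | .ex _ C => C.nr
  | .all _ C => C.nr
  | .atLeast k _ C => max k C.nr

/-! ### Monotonicity in the set of operators -/

theorem Role.inSig_mono {Os Os' : Finset Op} (h : Os ⊆ Os') {SR : Finset ℕ} {S : Role}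
    (hS : S.inSig Os SR) : S.inSig Os' SR := by
  cases S with
  | name R => exact hS
  | inv R => exact ⟨h hS.1, hS.2⟩

theorem Concept.inLang_mono {Os Os' : Finset Op} (h : Os ⊆ Os') {SC SR : Finset ℕ} {C : Concept}
    (hC : C.inLang Os SC SR) : C.inLang Os' SC SR := by
  induction C with
  | atom A => exact hC
  | top => exact h hC
  | bot => exact h hC
  | and C D ihC ihD => exact ⟨h hC.1, ihC hC.2.1, ihD hC.2.2⟩
  | or C D ihC ihD => exact ⟨h hC.1, ihC hC.2.1, ihD hC.2.2⟩
  | neg C ih => exact ⟨h hC.1, ih hC.2⟩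
  | ex S C ih => exact ⟨h hC.1, Role.inSig_mono h hC.2.1, ih hC.2.2⟩
  | all S C ih => exact ⟨h hC.1, Role.inSig_mono h hC.2.1, ih hC.2.2⟩
  | atLeast k S C ih => exact ⟨h hC.1, hC.2.1, Role.inSig_mono h hC.2.2.1, ih hC.2.2.2⟩

theorem AdmitsFinChar.mono {Os Os' : Finset Op} (h : Os ⊆ Os') (H : AdmitsFinChar Os') :
    AdmitsFinChar Os := by
  intro SC SR C hC
  obtain ⟨P, N, h₁, h₂, h₃⟩ := H SC SR C (Concept.inLang_mono h hC)
  exact ⟨P, N, h₁, h₂, fun D hD => h₃ D (Concept.inLang_mono h hD)⟩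

/-! ### Languages without finite characterisations -/

theorem not_admitsFinChar_of_indistinguishable {Os : Finset Op} {SC SR : Finset ℕ} {C : Concept}
    (hC : C.inLang Os SC SR)
    (H : ∀ N : ℕ, ∃ D : Concept, D.inLang Os SC SR ∧
      (∀ I : Interp, Finite I.Δ → Nat.card I.Δ ≤ N → C.sem I = D.sem I) ∧ ¬ CEquiv C D) :
    ¬ AdmitsFinChar Os := by
  intro hadm
  obtain ⟨P, N, hfin, hfit, huniq⟩ := hadm SC SR C hC
  have hbound : ∀ L : List PInterp, ∃ n, ∀ e ∈ L, Nat.card e.I.Δ ≤ n := by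
    intro L
    induction L with
    | nil => exact ⟨0, by simp⟩
    | cons a L ih =>
      obtain ⟨n, hn⟩ := ih
      refine ⟨max (Nat.card a.I.Δ) n, ?_⟩
      intro e he
      rcases List.mem_cons.1 he with rfl | he
      · exact le_max_left _ _
      · exact (hn e he).trans (le_max_right _ _)
  obtain ⟨n, hn⟩ := hbound (P ++ N)
  obtain ⟨D, hD, hsame, hne⟩ := H n
  have hsem : ∀ e ∈ P ++ N, C.sem e.I = D.sem e.I := fun e he => hsame e.I (hfin e he) (hn e he)
  refine hne (huniq D hD ⟨fun e he => ?_, fun e he => ?_⟩)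
  · rw [← hsem e (List.mem_append_left _ he)]
    exact hfit.1 e he
  · rw [← hsem e (List.mem_append_right _ he)]
    exact hfit.2 e he

/-- `Walk r n a b`: there is an `r`-walk of length `n` from `a` to `b`. -/
def Walk {α : Type} (r : α → α → Prop) : ℕ → α → α → Prop
  | 0, a, b => a = b
  | n + 1, a, b => ∃ c, r a c ∧ Walk r n c b

theorem Walk.append {α : Type} {r : α → α → Prop} {m n : ℕ} {a b c : α}
    (h : Walk r m a b) (h' : Walk r n b c) : Walk r (m + n) a c := by
  induction m generalizing a with
  | zero =>
    obtain rfl : a = b := h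
    simpa using h'
  | succ m ih =>
    obtain ⟨d, hd, hw⟩ := h
    rw [Nat.succ_add]
    exact ⟨d, hd, ih hw⟩

theorem Walk.split {α : Type} {r : α → α → Prop} {m n : ℕ} {a c : α}
    (h : Walk r (m + n) a c) : ∃ b, Walk r m a b ∧ Walk r n b c := by
  induction m generalizing a with
  | zero => exact ⟨a, rfl, by simpa using h⟩
  | succ m ih =>
    rw [Nat.succ_add] at h
    obtain ⟨d, hd, hw⟩ := h
    obtain ⟨b, h₁, h₂⟩ := ih hw
    exact ⟨b, ⟨d, hd, h₁⟩, h₂⟩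

theorem Walk.reverse {α : Type} {r : α → α → Prop} {n : ℕ} {a b : α}
    (h : Walk r n a b) : Walk (fun x y => r y x) n b a := by
  induction n generalizing a with
  | zero => exact Eq.symm h
  | succ n ih =>
    obtain ⟨c, hc, hw⟩ := h
    exact (ih hw).append (n := 1) ⟨a, hc, rfl⟩

theorem Walk.repeat {α : Type} {r : α → α → Prop} {p : ℕ} {a : α}
    (h : Walk r p a a) (k : ℕ) : Walk r (k * p) a a := by
  induction k with
  | zero =>
    rw [zero_mul]
    exact rfl
  | succ k ih =>
    rw [Nat.succ_mul]
    exact ih.append h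

theorem Walk.pump {α : Type} [Finite α] {r : α → α → Prop} {n : ℕ} (hn : Nat.card α ≤ n)
    {a b : α} (h : Walk r n a b) :
    ∃ p, 1 ≤ p ∧ p ≤ n ∧ ∀ k, Walk r (n + k * p) a b := by
  have hsplit : ∀ i : Fin (n + 1), ∃ c, Walk r i a c := by
    intro i
    have h' : Walk r (i + (n - i)) a b := by
      rwa [Nat.add_sub_cancel' (Nat.lt_succ_iff.1 i.2)]
    obtain ⟨c, hc, -⟩ := h'.split
    exact ⟨c, hc⟩
  have hseq : ∀ {m : ℕ} {a b : α}, Walk r m a b →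
      ∃ v : ℕ → α, v 0 = a ∧ v m = b ∧ ∀ i < m, r (v i) (v (i + 1)) := by
    intro m
    induction m with
    | zero => intro a b h; exact ⟨fun _ => a, rfl, h, by simp⟩
    | succ m ih =>
      rintro a b ⟨c, hc, hw⟩
      obtain ⟨v, hv0, hvm, hv⟩ := ih hw
      refine ⟨fun i => Nat.casesOn i a v, rfl, hvm, ?_⟩
      intro i hi
      cases i with
      | zero => simpa [hv0] using hc
      | succ i => exact hv i (by omega)
  obtain ⟨v, hv0, hvn, hv⟩ := hseq h
  have hseg : ∀ m i, i + m ≤ n → Walk r m (v i) (v (i + m)) := by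
    intro m
    induction m with
    | zero => intro i _; exact rfl
    | succ m ih =>
      intro i hi
      refine ⟨v (i + 1), hv i (by omega), ?_⟩
      have := ih (i + 1) (by omega)
      rwa [show i + 1 + m = i + (m + 1) by omega] at this
  obtain ⟨i, j, hij, hvij⟩ : ∃ i j : Fin (n + 1), i < j ∧ v i = v j := by
    have hninj : ¬ Function.Injective (fun i : Fin (n + 1) => v i) := by
      intro hinj
      have := Nat.card_le_card_of_injective _ hinj
      simp at this
      omega
    rw [Function.not_injective_iff] at hninj
    obtain ⟨i, j, he, hne⟩ := hninj
    rcases lt_or_gt_of_ne hne with hlt | hlt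
    · exact ⟨i, j, hlt, he⟩
    · exact ⟨j, i, hlt, he.symm⟩
  have hi := i.2
  have hj := j.2
  have hlt : (i : ℕ) < j := hij
  refine ⟨j - i, by omega, by omega, fun k => ?_⟩
  have h₁ := hseg i 0 (by omega)
  have h₂ := hseg (j - i) i (by omega)
  have h₃ := hseg (n - i) i (by omega)
  rw [show (i : ℕ) + (j - i) = j by omega, ← hvij] at h₂
  rw [show (i : ℕ) + (n - i) = n by omega, hvn] at h₃
  rw [zero_add, hv0] at h₁
  have := (h₁.append (h₂.repeat k)).append h₃
  rwa [show (i : ℕ) + k * (j - i) + (n - i) = n + k * (j - i) by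
    generalize k * ((j : ℕ) - i) = q
    omega] at this

theorem Walk.extend {α : Type} [Finite α] {r : α → α → Prop} {n : ℕ} (hn : Nat.card α ≤ n)
    {a b : α} (h : Walk r n a b) : ∃ c, Walk r (n + 1) a c := by
  obtain ⟨p, hp, -, hw⟩ := h.pump hn
  have := hw 1
  rw [show n + 1 * p = n + 1 + (p - 1) by omega] at this
  obtain ⟨c, hc, -⟩ := this.split
  exact ⟨c, hc⟩

/-- `n`-fold nesting of `∃S`. -/
def Concept.exIter (S : Role) (C : Concept) : ℕ → Concept
  | 0 => C
  | n + 1 => .ex S (Concept.exIter S C n)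

/-- `n`-fold nesting of `∀S`. -/
def Concept.allIter (S : Role) (C : Concept) : ℕ → Concept
  | 0 => C
  | n + 1 => .all S (Concept.allIter S C n)

theorem Concept.mem_sem_exIter {I : Interp} {S : Role} {C : Concept} {n : ℕ} {x : I.Δ} :
    x ∈ (Concept.exIter S C n).sem I ↔ ∃ y, Walk (S.sem I) n x y ∧ y ∈ C.sem I := by
  induction n generalizing x with
  | zero => simp [Concept.exIter, Walk]
  | succ n ih =>
    simp only [Concept.exIter, Concept.sem, Set.mem_ofPred_eq, ih, Walk]
    grind

theorem Concept.mem_sem_allIter {I : Interp} {S : Role} {C : Concept} {n : ℕ} {x : I.Δ} :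
    x ∈ (Concept.allIter S C n).sem I ↔ ∀ y, Walk (S.sem I) n x y → y ∈ C.sem I := by
  induction n generalizing x with
  | zero => simp [Concept.allIter, Walk]
  | succ n ih =>
    simp only [Concept.allIter, Concept.sem, Set.mem_ofPred_eq, ih, Walk]
    grind

theorem Concept.inLang_exIter {Os : Finset Op} {SC SR : Finset ℕ} {S : Role} {C : Concept}
    (hex : Op.ex ∈ Os) (hS : S.inSig Os SR) (hC : C.inLang Os SC SR) (n : ℕ) :
    (Concept.exIter S C n).inLang Os SC SR := by
  induction n with
  | zero => exact hC
  | succ n ih => exact ⟨hex, hS, ih⟩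

theorem Concept.inLang_allIter {Os : Finset Op} {SC SR : Finset ℕ} {S : Role} {C : Concept}
    (hall : Op.all ∈ Os) (hS : S.inSig Os SR) (hC : C.inLang Os SC SR) (n : ℕ) :
    (Concept.allIter S C n).inLang Os SC SR := by
  induction n with
  | zero => exact hC
  | succ n ih => exact ⟨hall, hS, ih⟩

/-- The directed path `0 → 1 → ⋯ → n`, extended by isolated points. -/
def pathInterp (n : ℕ) : Interp where
  Δ := ℕ
  dom_nonempty := ⟨0⟩
  atom _ := ∅
  rel _ a b := b = a + 1 ∧ b ≤ n

theorem walk_pathInterp {n m a b : ℕ} (h : Walk ((pathInterp n).rel 0) m a b) :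
    b = a + m ∧ (b ≤ n ∨ m = 0) := by
  induction m generalizing a with
  | zero => exact ⟨Eq.symm h, Or.inr rfl⟩
  | succ m ih =>
    obtain ⟨c, ⟨hc, hcn⟩, hw⟩ := h
    obtain ⟨h₁, h₂⟩ := ih hw
    omega

theorem walk_pathInterp_zero {n m : ℕ} (h : m ≤ n) :
    Walk ((pathInterp n).rel 0) m (0 : ℕ) m := by
  induction m with
  | zero => exact rfl
  | succ m ih => exact (ih (by omega)).append (n := 1) ⟨m + 1, ⟨rfl, h⟩, rfl⟩

/-- The infinite directed path whose root alone satisfies every concept name. -/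
def rayInterp : Interp where
  Δ := ℕ
  dom_nonempty := ⟨0⟩
  atom _ := {0}
  rel _ a b := b = a + 1

theorem walk_rayInterp {m : ℕ} : Walk (rayInterp.rel 0) m (0 : ℕ) m := by
  induction m with
  | zero => exact rfl
  | succ m ih => exact ih.append (n := 1) ⟨m + 1, rfl, rfl⟩

theorem walk_inv_rayInterp {m a b : ℕ} (h : Walk ((Role.inv 0).sem rayInterp) m a b) :
    a = b + m := by
  induction m generalizing a with
  | zero => exact h
  | succ m ih =>
    obtain ⟨c, hc, hw⟩ := h
    have h₁ : a = (show ℕ from c) + 1 := hc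
    have h₂ : (show ℕ from c) = b + m := ih hw
    omega

theorem not_admitsFinChar_ex_and_neg : ¬ AdmitsFinChar {Op.ex, Op.and, Op.neg} := by
  let A : Concept := .atom 0
  let F : Concept := .and A (.neg A)
  have hF : F.inLang {Op.ex, Op.and, Op.neg} {0} {0} := by
    simp [F, A, Concept.inLang]
  have hT : (Concept.neg F).inLang {Op.ex, Op.and, Op.neg} {0} {0} := ⟨by simp, hF⟩
  have hR : (Role.name 0).inSig {Op.ex, Op.and, Op.neg} {0} := by simp [Role.inSig]
  have hsF : ∀ I : Interp, F.sem I = ∅ := by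
    intro I
    simp [F, Concept.sem]
  have hsT : ∀ I : Interp, (Concept.neg F).sem I = Set.univ := by
    intro I
    simp [Concept.sem, hsF I]
  refine not_admitsFinChar_of_indistinguishable (C := F) hF fun N => ?_
  refine ⟨.and (.exIter (.name 0) (.neg F) N) (.neg (.exIter (.name 0) (.neg F) (N + 1))),
    ⟨by simp, Concept.inLang_exIter (by simp) hR hT _, by simp,
      Concept.inLang_exIter (by simp) hR hT _⟩, ?_, ?_⟩
  · intro I _ hI
    rw [hsF, eq_comm, Set.eq_empty_iff_forall_notMem]
    rintro x ⟨hx, hx'⟩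
    obtain ⟨y, hy, -⟩ := Concept.mem_sem_exIter.1 hx
    obtain ⟨c, hc⟩ := hy.extend hI
    exact hx' (Concept.mem_sem_exIter.2 ⟨c, hc, by simp [hsT]⟩)
  · intro he
    have := he (pathInterp N)
    rw [hsF, eq_comm, Set.eq_empty_iff_forall_notMem] at this
    refine this (0 : ℕ) ⟨?_, ?_⟩
    · exact Concept.mem_sem_exIter.2 ⟨N, walk_pathInterp_zero le_rfl, hsT _ ▸ trivial⟩
    · intro h
      obtain ⟨y, hy, -⟩ := Concept.mem_sem_exIter.1 h
      have := walk_pathInterp hy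
      omega

theorem not_admitsFinChar_ex_and_ge_or : ¬ AdmitsFinChar {Op.ex, Op.and, Op.ge, Op.or} := by
  refine not_admitsFinChar_of_indistinguishable (SC := {0}) (SR := {0}) (C := .atom 0)
    (by simp [Concept.inLang]) fun N => ?_
  refine ⟨.or (.atom 0) (.atLeast (N + 1) (.name 0) (.atom 0)),
    by simp [Concept.inLang, Role.inSig], ?_, ?_⟩
  · intro I _ hI
    refine (Set.union_eq_left.2 ?_).symm
    rintro x ⟨s, hs, -⟩
    have := Nat.card_le_card_of_injective (Subtype.val : s → I.Δ) Subtype.val_injective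
    simp at this
    omega
  · intro he
    let I : Interp := ⟨ℕ, ⟨0⟩, fun _ => {x | 0 < x}, fun _ _ _ => True⟩
    have h0 : (0 : ℕ) ∉ (Concept.atom 0).sem I := fun h => lt_irrefl 0 (show 0 < 0 from h)
    rw [he I] at h0
    refine h0 (Or.inr ⟨(Finset.range (N + 1)).map ⟨Nat.succ, Nat.succ_injective⟩,
      (Finset.card_map _).trans (Finset.card_range _), ?_⟩)
    intro e hme
    obtain ⟨i, -, rfl⟩ := Finset.mem_map.1 hme
    exact ⟨trivial, Nat.succ_pos i⟩

theorem not_admitsFinChar_ex_and_ge_bot : ¬ AdmitsFinChar {Op.ex, Op.and, Op.ge, Op.bot} := by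
  refine not_admitsFinChar_of_indistinguishable (SC := {0}) (SR := {0}) (C := .bot)
    (by simp [Concept.inLang]) fun N => ?_
  refine ⟨.atLeast (N + 1) (.name 0) (.atom 0),
    by simp [Concept.inLang, Role.inSig], ?_, ?_⟩
  · intro I _ hI
    refine (Set.eq_empty_iff_forall_notMem.2 ?_).symm
    rintro x ⟨s, hs, -⟩
    have := Nat.card_le_card_of_injective (Subtype.val : s → I.Δ) Subtype.val_injective
    simp at this
    omega
  · intro he
    let I : Interp := ⟨ℕ, ⟨0⟩, fun _ => Set.univ, fun _ _ _ => True⟩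
    have h0 : (0 : ℕ) ∉ Concept.bot.sem I := fun h => h
    rw [he I] at h0
    exact h0 ⟨Finset.range (N + 1), Finset.card_range _, fun e _ => ⟨trivial, trivial⟩⟩

theorem not_admitsFinChar_ex_and_all_inv : ¬ AdmitsFinChar {Op.ex, Op.and, Op.all, Op.inv} := by
  refine not_admitsFinChar_of_indistinguishable (SC := {0}) (SR := {0}) (C := .atom 0)
    (by simp [Concept.inLang]) fun N => ?_
  refine ⟨.and (.atom 0)
    (.allIter (.name 0) (.exIter (.inv 0) (.atom 0) (N + N.factorial)) N),
    ⟨by simp, by simp [Concept.inLang], Concept.inLang_allIter (by simp) (by simp [Role.inSig])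
      (Concept.inLang_exIter (by simp) (by simp [Role.inSig]) (by simp [Concept.inLang]) _) _⟩,
    ?_, ?_⟩
  · intro I _ hI
    refine (Set.inter_eq_left.2 fun x hx => ?_).symm
    refine Concept.mem_sem_allIter.2 fun y hy => Concept.mem_sem_exIter.2 ⟨x, ?_, hx⟩
    obtain ⟨p, hp, hpN, hw⟩ := hy.pump hI
    obtain ⟨k, hk⟩ := Nat.dvd_factorial hp hpN
    have := (hw k).reverse
    rwa [mul_comm, ← hk] at this
  · intro he
    have h0 : (0 : ℕ) ∈ (Concept.atom 0).sem rayInterp := rfl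
    rw [he rayInterp] at h0
    obtain ⟨y, hy, -⟩ := Concept.mem_sem_exIter.1
      (Concept.mem_sem_allIter.1 h0.2 N walk_rayInterp)
    have h₁ : N = (show ℕ from y) + (N + N.factorial) := walk_inv_rayInterp hy
    have := Nat.factorial_pos N
    omega

theorem not_admitsFinChar_ex_and_all_bot : ¬ AdmitsFinChar {Op.ex, Op.and, Op.all, Op.bot} := by
  refine not_admitsFinChar_of_indistinguishable (SC := {0}) (SR := {0}) (C := .bot)
    (by simp [Concept.inLang]) fun N => ?_
  refine ⟨.and (.exIter (.name 0) (.all (.name 0) .bot) N) (.allIter (.name 0) .bot (N + 1)),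
    ⟨by simp, Concept.inLang_exIter (by simp) (by simp [Role.inSig])
      (by simp [Concept.inLang, Role.inSig]) _,
      Concept.inLang_allIter (by simp) (by simp [Role.inSig]) (by simp [Concept.inLang]) _⟩,
    ?_, ?_⟩
  · intro I _ hI
    refine (Set.eq_empty_iff_forall_notMem.2 ?_).symm
    rintro x ⟨hx, hx'⟩
    obtain ⟨y, hy, -⟩ := Concept.mem_sem_exIter.1 hx
    obtain ⟨c, hc⟩ := hy.extend hI
    exact Concept.mem_sem_allIter.1 hx' c hc
  · intro he
    have h0 : (0 : ℕ) ∉ Concept.bot.sem (pathInterp N) := fun h => h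
    rw [he] at h0
    refine h0 ⟨Concept.mem_sem_exIter.2 ⟨N, walk_pathInterp_zero le_rfl, ?_⟩,
      Concept.mem_sem_allIter.2 fun y hy => ?_⟩
    · rintro e ⟨he₁, he₂⟩
      have h₁ : (show ℕ from e) = N + 1 := he₁
      have h₂ : (show ℕ from e) ≤ N := he₂
      omega
    · have := walk_pathInterp hy
      omega

theorem not_admitsFinChar_ex_and_all_or_top :
    ¬ AdmitsFinChar {Op.ex, Op.and, Op.all, Op.or, Op.top} := by
  refine not_admitsFinChar_of_indistinguishable (SC := {0}) (SR := {0}) (C := .top)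
    (by simp [Concept.inLang]) fun N => ?_
  refine ⟨.or (.exIter (.name 0) .top (N + 1)) (.allIter (.name 0) (.ex (.name 0) .top) N),
    ⟨by simp, Concept.inLang_exIter (by simp) (by simp [Role.inSig]) (by simp [Concept.inLang]) _,
      Concept.inLang_allIter (by simp) (by simp [Role.inSig])
      (by simp [Concept.inLang, Role.inSig]) _⟩,
    ?_, ?_⟩
  · intro I _ hI
    refine (Set.eq_univ_iff_forall.2 fun x => ?_).symm
    by_cases hx : ∃ c, Walk (I.rel 0) (N + 1) x c
    · obtain ⟨c, hc⟩ := hx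
      exact Or.inl (Concept.mem_sem_exIter.2 ⟨c, hc, trivial⟩)
    · exact Or.inr (Concept.mem_sem_allIter.2 fun y hy => (hx (Walk.extend hI hy)).elim)
  · intro he
    have h0 : (0 : ℕ) ∈ Concept.top.sem (pathInterp N) := trivial
    rw [he] at h0
    rcases h0 with h0 | h0
    · obtain ⟨y, hy, -⟩ := Concept.mem_sem_exIter.1 h0
      have := walk_pathInterp hy
      omega
    · obtain ⟨e, ⟨he₁, he₂⟩, -⟩ :=
        Concept.mem_sem_allIter.1 h0 N (walk_pathInterp_zero le_rfl)
      have h₁ : (show ℕ from e) = N + 1 := he₁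
      have h₂ : (show ℕ from e) ≤ N := he₂
      omega

/-! ### Building finite characterisations -/

theorem finChar_of_subsumes {L : Concept → Prop} {C : Concept} {P N : List PInterp}
    (hP : ∀ e ∈ P, e.finite ∧ e.pt ∈ C.sem e.I) (hN : ∀ e ∈ N, e.finite ∧ e.pt ∉ C.sem e.I)
    (H : ∀ D, L D → Fits D P N → Subsumes C D ∧ Subsumes D C) : FinChar L C P N := by
  refine ⟨fun e he => ?_, ⟨fun e he => (hP e he).2, fun e he => (hN e he).2⟩,
    fun D hD hfit I => ?_⟩
  · rcases List.mem_append.1 he with he | he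
    · exact (hP e he).1
    · exact (hN e he).1
  · exact ((H D hD hfit).1 I).antisymm ((H D hD hfit).2 I)

theorem exists_list_pointed (I : Interp) [Finite I.Δ] (X : Set I.Δ) :
    ∃ L : List PInterp, (∀ e ∈ L, ∃ x ∈ X, e = ⟨I, x⟩) ∧ ∀ x ∈ X, (⟨I, x⟩ : PInterp) ∈ L := by
  refine ⟨(Set.toFinite X).toFinset.toList.map fun x => ⟨I, x⟩, ?_, ?_⟩
  · intro e he
    obtain ⟨x, hx, rfl⟩ := List.mem_map.1 he
    exact ⟨x, by simpa using hx, rfl⟩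
  · intro x hx
    exact List.mem_map.2 ⟨x, by simpa using hx, rfl⟩

/-! ### The positive existential language -/

/-- Homomorphisms of interpretations. -/
def IsHom (I J : Interp) (f : I.Δ → J.Δ) : Prop :=
  (∀ A x, x ∈ I.atom A → f x ∈ J.atom A) ∧ ∀ R x y, I.rel R x y → J.rel R (f x) (f y)

/-- The operators of the positive existential language. -/
abbrev posExOps : Finset Op := {Op.ex, Op.inv, Op.and, Op.or, Op.top, Op.bot}

theorem IsHom.role {I J : Interp} {f : I.Δ → J.Δ} (hf : IsHom I J f) {S : Role} {x y : I.Δ}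
    (h : S.sem I x y) : S.sem J (f x) (f y) := by
  cases S with
  | name R => exact hf.2 R x y h
  | inv R => exact hf.2 R y x h

theorem IsHom.mem_sem {I J : Interp} {f : I.Δ → J.Δ} (hf : IsHom I J f) {SC SR : Finset ℕ}
    {C : Concept} (hC : C.inLang posExOps SC SR) {x : I.Δ} (hx : x ∈ C.sem I) :
    f x ∈ C.sem J := by
  induction C generalizing x with
  | atom A => exact hf.1 A x hx
  | top => trivial
  | bot => exact hx
  | and C D ihC ihD => exact ⟨ihC hC.2.1 hx.1, ihD hC.2.2 hx.2⟩
  | or C D ihC ihD => exact hx.imp (ihC hC.2.1) (ihD hC.2.2)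
  | neg C ih => simp [Concept.inLang] at hC
  | ex S C ih =>
    obtain ⟨y, hy, hyC⟩ := hx
    exact ⟨f y, hf.role hy, ih hC.2.2 hyC⟩
  | all S C ih => simp [Concept.inLang] at hC
  | atLeast k S C ih => simp [Concept.inLang] at hC

/-- A single point satisfying exactly the given concept names. -/
def pointInterp (X : Set ℕ) : Interp where
  Δ := Unit
  dom_nonempty := ⟨()⟩
  atom A := {_x | A ∈ X}
  rel _ _ _ := False

/-- The disjoint union of `I` and `J` with the points `a` and `b` identified, realised inside the
product: `x` becomes `(x, b)` and `y` becomes `(a, y)`. -/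
def wedge (I J : Interp) (a : I.Δ) (b : J.Δ) : Interp where
  Δ := I.Δ × J.Δ
  dom_nonempty := ⟨(a, b)⟩
  atom A := {p | p.2 = b ∧ p.1 ∈ I.atom A ∨ p.1 = a ∧ p.2 ∈ J.atom A}
  rel R p q := (p.2 = b ∧ q.2 = b ∧ I.rel R p.1 q.1) ∨ (p.1 = a ∧ q.1 = a ∧ J.rel R p.2 q.2)

/-- The interpretation `I` with a new root that has `a` as its only neighbour, via `S`. -/
def addRoot (S : Role) (I : Interp) (a : I.Δ) : Interp where
  Δ := Option I.Δ
  dom_nonempty := ⟨none⟩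
  atom A := {p | ∃ x ∈ I.atom A, p = some x}
  rel R p q := (∃ x y, p = some x ∧ q = some y ∧ I.rel R x y) ∨
    (S = .name R ∧ p = none ∧ q = some a) ∨ (S = .inv R ∧ p = some a ∧ q = none)

theorem exists_canonical {SC SR : Finset ℕ} {C : Concept} (hC : C.inLang posExOps SC SR) :
    ∃ L : List PInterp, (∀ e ∈ L, e.finite ∧ e.pt ∈ C.sem e.I) ∧
      ∀ (I : Interp) (d : I.Δ), d ∈ C.sem I → ∃ e ∈ L, ∃ f, IsHom e.I I f ∧ f e.pt = d := by
  classical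
  induction C with
  | atom A =>
    refine ⟨[⟨pointInterp {A}, ()⟩], ?_, fun I d hd => ⟨_, List.mem_singleton_self _,
      fun _ => d, ⟨?_, ?_⟩, rfl⟩⟩
    · simp only [List.mem_singleton, forall_eq]
      exact ⟨inferInstanceAs (Finite Unit), rfl⟩
    · intro B x hB
      obtain rfl : B = A := hB
      exact hd
    · rintro R x y ⟨⟩
  | top =>
    refine ⟨[⟨pointInterp ∅, ()⟩], ?_, fun I d hd => ⟨_, List.mem_singleton_self _,
      fun _ => d, ⟨?_, ?_⟩, rfl⟩⟩
    · simp only [List.mem_singleton, forall_eq]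
      exact ⟨inferInstanceAs (Finite Unit), trivial⟩
    · rintro B x ⟨⟩
    · rintro R x y ⟨⟩
  | bot => exact ⟨[], by simp, fun I d hd => hd.elim⟩
  | and C D ihC ihD =>
    obtain ⟨L, hL, hL'⟩ := ihC hC.2.1
    obtain ⟨M, hM, hM'⟩ := ihD hC.2.2
    refine ⟨L.flatMap fun e => M.map fun e' => ⟨wedge e.I e'.I e.pt e'.pt, (e.pt, e'.pt)⟩,
      ?_, ?_⟩
    · intro e he
      simp only [List.mem_flatMap, List.mem_map] at he
      obtain ⟨e₁, h₁, e₂, h₂, rfl⟩ := he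
      have hf₁ := (hL e₁ h₁).1
      have hf₂ := (hM e₂ h₂).1
      unfold PInterp.finite at hf₁ hf₂
      refine ⟨inferInstanceAs (Finite (e₁.I.Δ × e₂.I.Δ)), ?_, ?_⟩
      · have hom : IsHom e₁.I (wedge e₁.I e₂.I e₁.pt e₂.pt) fun x => (x, e₂.pt) :=
          ⟨fun A x hx => Or.inl ⟨rfl, hx⟩, fun R x y hxy => Or.inl ⟨rfl, rfl, hxy⟩⟩
        exact hom.mem_sem hC.2.1 (hL e₁ h₁).2
      · have hom : IsHom e₂.I (wedge e₁.I e₂.I e₁.pt e₂.pt) fun x => (e₁.pt, x) :=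
          ⟨fun A x hx => Or.inr ⟨rfl, hx⟩, fun R x y hxy => Or.inr ⟨rfl, rfl, hxy⟩⟩
        exact hom.mem_sem hC.2.2 (hM e₂ h₂).2
    · intro I d hd
      obtain ⟨e₁, h₁, f, hf, hfd⟩ := hL' I d hd.1
      obtain ⟨e₂, h₂, g, hg, hgd⟩ := hM' I d hd.2
      refine ⟨⟨wedge e₁.I e₂.I e₁.pt e₂.pt, (e₁.pt, e₂.pt)⟩,
        List.mem_flatMap.2 ⟨e₁, h₁, List.mem_map.2 ⟨e₂, h₂, rfl⟩⟩,
        fun p => if p.2 = e₂.pt then f p.1 else g p.2, ?_, by simp [hfd]⟩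
      have hval : ∀ y, (if y = e₂.pt then f e₁.pt else g y) = g y := by
        intro y
        split_ifs with h
        · rw [h, hfd, hgd]
        · rfl
      refine ⟨?_, ?_⟩
      · rintro A ⟨x, y⟩ (⟨hy, hx⟩ | ⟨hx, hy⟩)
        · simp only at hy hx
          simpa [hy] using hf.1 A x hx
        · simp only at hy hx
          simpa only [hx, hval] using hg.1 A y hy
      · rintro R ⟨x, y⟩ ⟨x', y'⟩ (⟨hy, hy', h⟩ | ⟨hx, hx', h⟩)
        · simp only at hy hy' h
          simpa [hy, hy'] using hf.2 R x x' h
        · simp only at hx hx' h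
          simpa only [hx, hx', hval] using hg.2 R y y' h
  | or C D ihC ihD =>
    obtain ⟨L, hL, hL'⟩ := ihC hC.2.1
    obtain ⟨M, hM, hM'⟩ := ihD hC.2.2
    refine ⟨L ++ M, fun e he => ?_, fun I d hd => ?_⟩
    · rcases List.mem_append.1 he with he | he
      · exact ⟨(hL e he).1, Or.inl (hL e he).2⟩
      · exact ⟨(hM e he).1, Or.inr (hM e he).2⟩
    · rcases hd with hd | hd
      · obtain ⟨e, he, h⟩ := hL' I d hd
        exact ⟨e, List.mem_append_left _ he, h⟩
      · obtain ⟨e, he, h⟩ := hM' I d hd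
        exact ⟨e, List.mem_append_right _ he, h⟩
  | neg C ih => simp [Concept.inLang] at hC
  | ex S C ih =>
    obtain ⟨L, hL, hL'⟩ := ih hC.2.2
    refine ⟨L.map fun e => ⟨addRoot S e.I e.pt, none⟩, ?_, ?_⟩
    · intro e he
      obtain ⟨e, he', rfl⟩ := List.mem_map.1 he
      have hfin := (hL e he').1
      unfold PInterp.finite at hfin
      refine ⟨inferInstanceAs (Finite (Option e.I.Δ)), some e.pt, ?_, ?_⟩
      · cases S with
        | name R => exact Or.inr (Or.inl ⟨rfl, rfl, rfl⟩)
        | inv R => exact Or.inr (Or.inr ⟨rfl, rfl, rfl⟩)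
      · have hom : IsHom e.I (addRoot S e.I e.pt) some :=
          ⟨fun A x hx => ⟨x, hx, rfl⟩, fun R x y hxy => Or.inl ⟨x, y, rfl, rfl, hxy⟩⟩
        exact hom.mem_sem hC.2.2 (hL e he').2
    · rintro I d ⟨c, hdc, hc⟩
      obtain ⟨e, he, f, hf, hfc⟩ := hL' I c hc
      refine ⟨⟨addRoot S e.I e.pt, none⟩, List.mem_map.2 ⟨e, he, rfl⟩,
        fun p => p.elim d f, ⟨?_, ?_⟩, rfl⟩
      · rintro A p ⟨x, hx, rfl⟩
        exact hf.1 A x hx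
      · rintro R p q (⟨x, y, rfl, rfl, hxy⟩ | ⟨rfl, rfl, rfl⟩ | ⟨rfl, rfl, rfl⟩)
        · exact hf.2 R x y hxy
        · simpa [hfc] using! hdc
        · simpa [hfc] using! hdc
  | all S C ih => simp [Concept.inLang] at hC
  | atLeast k S C ih => simp [Concept.inLang] at hC

/-- The subconcepts of a concept. -/
def Concept.subs : Concept → Finset Concept
  | .atom A => {.atom A}
  | .top => {.top}
  | .bot => {.bot}
  | .and C D => insert (.and C D) (C.subs ∪ D.subs)
  | .or C D => insert (.or C D) (C.subs ∪ D.subs)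
  | .neg C => insert (.neg C) C.subs
  | .ex S C => insert (.ex S C) C.subs
  | .all S C => insert (.all S C) C.subs
  | .atLeast k S C => insert (.atLeast k S C) C.subs

theorem Concept.self_mem_subs (C : Concept) : C ∈ C.subs := by
  cases C <;> simp [Concept.subs]

theorem Concept.subs_trans {C D : Concept} (h : D ∈ C.subs) : D.subs ⊆ C.subs := by
  induction C with
  | atom A => simp only [subs, Finset.mem_singleton] at h; simp [h]
  | top => simp only [subs, Finset.mem_singleton] at h; simp [h]
  | bot => simp only [subs, Finset.mem_singleton] at h; simp [h]
  | and E F ihE ihF =>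
    simp only [subs, Finset.mem_insert, Finset.mem_union] at h
    rcases h with rfl | h | h
    · exact subset_rfl
    · exact (ihE h).trans fun x hx => by simp [subs, hx]
    · exact (ihF h).trans fun x hx => by simp [subs, hx]
  | or E F ihE ihF =>
    simp only [subs, Finset.mem_insert, Finset.mem_union] at h
    rcases h with rfl | h | h
    · exact subset_rfl
    · exact (ihE h).trans fun x hx => by simp [subs, hx]
    · exact (ihF h).trans fun x hx => by simp [subs, hx]
  | neg E ih | ex S E ih | all S E ih | atLeast k S E ih =>
    simp only [subs, Finset.mem_insert] at h
    rcases h with rfl | h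
    · exact subset_rfl
    · exact (ih h).trans fun x hx => by simp [subs, hx]

/-- The set of concepts in `Γ` satisfied at a point. -/
def typeIn (Γ : Finset Concept) (I : Interp) (x : I.Δ) : Set Concept :=
  {E | E ∈ Γ ∧ x ∈ E.sem I}

/-- The interpretation whose points are the types over `Γ` that are realised somewhere, with as
many edges and concept names as the concepts of `Γ` allow. -/
def typeInterp (Γ : Finset Concept) : Interp where
  Δ := {t : Set Concept // ∃ (I : Interp) (x : I.Δ), t = typeIn Γ I x}
  dom_nonempty := ⟨⟨_, pointInterp ∅, (), rfl⟩⟩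
  atom A := {t | .atom A ∈ Γ → .atom A ∈ t.1}
  rel R t u := (∀ E, .ex (.name R) E ∈ Γ → E ∈ u.1 → .ex (.name R) E ∈ t.1) ∧
    ∀ E, .ex (.inv R) E ∈ Γ → E ∈ t.1 → .ex (.inv R) E ∈ u.1

theorem finite_typeInterp (Γ : Finset Concept) : Finite (typeInterp Γ).Δ := by
  refine (Set.Finite.subset (Γ.finite_toSet.finite_subsets) ?_ :
    {t : Set Concept | ∃ (I : Interp) (x : I.Δ), t = typeIn Γ I x}.Finite)
  rintro t ⟨I, x, rfl⟩ E hE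
  exact hE.1

theorem isHom_typeIn (Γ : Finset Concept) (I : Interp) :
    IsHom I (typeInterp Γ) fun x => ⟨typeIn Γ I x, I, x, rfl⟩ :=
  ⟨fun _ _ hx hA => ⟨hA, hx⟩, fun _ x y hxy =>
    ⟨fun _ hE hy => ⟨hE, y, hxy, hy.2⟩, fun _ hE hx => ⟨hE, x, hxy, hx.2⟩⟩⟩

theorem mem_of_mem_sem_typeInterp {Γ : Finset Concept} {SC SR : Finset ℕ} {C : Concept}
    (hC : C.inLang posExOps SC SR) (hΓ : C.subs ⊆ Γ) {t : (typeInterp Γ).Δ}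
    (h : t ∈ C.sem (typeInterp Γ)) : C ∈ t.1 := by
  induction C generalizing t with
  | atom A => exact h (hΓ (Concept.self_mem_subs _))
  | top =>
    obtain ⟨_, I, x, rfl⟩ := t
    exact ⟨hΓ (Concept.self_mem_subs _), trivial⟩
  | bot => exact h.elim
  | and C D ihC ihD =>
    have hC' := ihC hC.2.1 (fun x hx => hΓ (by simp [Concept.subs, hx])) h.1
    have hD' := ihD hC.2.2 (fun x hx => hΓ (by simp [Concept.subs, hx])) h.2
    obtain ⟨_, I, x, rfl⟩ := t
    exact ⟨hΓ (Concept.self_mem_subs _), hC'.2, hD'.2⟩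
  | or C D ihC ihD =>
    have h' : C ∈ t.1 ∨ D ∈ t.1 :=
      h.imp (fun h => ihC hC.2.1 (fun x hx => hΓ (by simp [Concept.subs, hx])) h)
        fun h => ihD hC.2.2 (fun x hx => hΓ (by simp [Concept.subs, hx])) h
    obtain ⟨_, I, x, rfl⟩ := t
    exact ⟨hΓ (Concept.self_mem_subs _), h'.imp (fun h => h.2) fun h => h.2⟩
  | neg C ih => simp [Concept.inLang] at hC
  | ex S C ih =>
    obtain ⟨u, htu, hu⟩ := h
    have hCu := ih hC.2.2 (fun x hx => hΓ (by simp [Concept.subs, hx])) hu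
    cases S with
    | name R => exact htu.1 C (hΓ (Concept.self_mem_subs _)) hCu
    | inv R => exact htu.2 C (hΓ (Concept.self_mem_subs _)) hCu
  | all S C ih => simp [Concept.inLang] at hC
  | atLeast k S C ih => simp [Concept.inLang] at hC

theorem admitsFinChar_posExOps : AdmitsFinChar posExOps := by
  intro SC SR C hC
  obtain ⟨P, hP, hP'⟩ := exists_canonical hC
  have := finite_typeInterp C.subs
  obtain ⟨N, hN, hN'⟩ := exists_list_pointed (typeInterp C.subs) (C.sem (typeInterp C.subs))ᶜ
  refine ⟨P, N, finChar_of_subsumes hP ?_ fun D hD hfit => ⟨fun I d hd => ?_, fun I d hd => ?_⟩⟩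
  · intro e he
    obtain ⟨x, hx, rfl⟩ := hN e he
    exact ⟨this, hx⟩
  · obtain ⟨e, he, f, hf, rfl⟩ := hP' I d hd
    exact hf.mem_sem hD (hfit.1 e he)
  · by_contra hdC
    refine hfit.2 _ (hN' _ fun h => ?_) ((isHom_typeIn C.subs I).mem_sem hD hd)
    exact hdC (mem_of_mem_sem_typeInterp hC subset_rfl h).2

/-! ### Unravelling up to a given depth -/

theorem exists_finset_of_card_fiber_le {α β γ : Type} [DecidableEq γ] (S : Finset α) (g : α → γ)
    (T : Set β) (h : β → γ)
    (H : ∀ j, ((S.filter (g · = j)).card : ℕ∞) ≤ {b | b ∈ T ∧ h b = j}.encard) :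
    ∃ S' : Finset β, S'.card = S.card ∧ ∀ b ∈ S', b ∈ T ∧ ∃ a ∈ S, h b = g a := by
  classical
  have hY : ∀ j, ∃ Y : Finset β, Y.card = (S.filter (g · = j)).card ∧
      ∀ b ∈ Y, b ∈ T ∧ h b = j := by
    intro j
    obtain ⟨t, ht, hcard⟩ := Set.exists_subset_encard_eq (H j)
    have hfin : t.Finite := Set.finite_of_encard_eq_coe hcard
    refine ⟨hfin.toFinset, ?_, fun b hb => ht (by simpa using hb)⟩
    rw [hfin.encard_eq_coe_toFinset_card] at hcard
    exact_mod_cast hcard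
  choose Y hYcard hYmem using hY
  refine ⟨(S.image g).biUnion Y, ?_, ?_⟩
  · rw [Finset.card_biUnion, Finset.card_eq_sum_card_image g S]
    · exact Finset.sum_congr rfl fun j _ => hYcard j
    · intro j _ j' _ hne
      refine Finset.disjoint_left.2 fun b hb hb' => hne ?_
      rw [← (hYmem j b hb).2, (hYmem j' b hb').2]
  · intro b hb
    obtain ⟨j, hj, hbj⟩ := Finset.mem_biUnion.1 hb
    obtain ⟨a, ha, rfl⟩ := Finset.mem_image.1 hj
    exact ⟨(hYmem _ b hbj).1, a, ha, (hYmem _ b hbj).2⟩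

theorem encard_fin_lt_le (n : ℕ) (c : ℕ∞) : {i : Fin n | ((i : ℕ) : ℕ∞) < c}.encard ≤ c := by
  induction c with
  | top => exact le_top
  | coe c =>
    have h : (Fin.val '' {i : Fin n | ((i : ℕ) : ℕ∞) < c}) ⊆ (Finset.range c : Set ℕ) := by
      rintro _ ⟨i, hi, rfl⟩
      simpa using hi
    rw [← Fin.val_injective.encard_image]
    refine (Set.encard_le_encard h).trans ?_
    rw [Set.encard_coe_eq_coe_finsetCard, Finset.card_range]

theorem le_encard_fin_lt {n m : ℕ} {c : ℕ∞} (hn : m ≤ n) (hc : (m : ℕ∞) ≤ c) :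
    (m : ℕ∞) ≤ {i : Fin n | ((i : ℕ) : ℕ∞) < c}.encard := by
  have h : Set.range (Fin.castLE hn) ⊆ {i : Fin n | ((i : ℕ) : ℕ∞) < c} := by
    rintro _ ⟨i, rfl⟩
    exact lt_of_lt_of_le (by exact_mod_cast i.2) hc
  refine le_trans ?_ (Set.encard_le_encard h)
  rw [← Set.image_univ, (Fin.castLE_injective hn).encard_image, Set.encard_univ]
  simp

/-- `N + 1` disjoint copies of `J`, together with a new point for every choice of concept names
and of successors among these copies. -/
def extend (SC SR : Finset ℕ) (N : ℕ) (J : Interp) : Interp where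
  Δ := (J.Δ × Fin (N + 1)) ⊕ (Set SC × (SR → Set (J.Δ × Fin (N + 1))))
  dom_nonempty := ⟨.inr (∅, fun _ => ∅)⟩
  atom A := {z | z.elim (fun p => p.1 ∈ J.atom A) fun t => ∃ h : A ∈ SC, ⟨A, h⟩ ∈ t.1}
  rel R z w := z.elim (fun p => ∃ q, w = .inl q ∧ J.rel R p.1 q.1 ∧ p.2 = q.2)
    fun t => ∃ q, w = .inl q ∧ ∃ h : R ∈ SR, q ∈ t.2 ⟨R, h⟩

/-- The new point of `extend SC SR N J` that imitates `x` when every successor `y` of `x` is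
imitated by `s y`. -/
noncomputable def lift (SC SR : Finset ℕ) (N : ℕ) {I J : Interp} (s : I.Δ → J.Δ) (x : I.Δ) :
    (extend SC SR N J).Δ :=
  .inr ({A | x ∈ I.atom A},
    fun R => {p | ((p.2 : ℕ) : ℕ∞) < {y | I.rel R x y ∧ s y = p.1}.encard})

section Extend

variable {SC SR : Finset ℕ} {N : ℕ} {I J : Interp}

theorem mem_sem_extend_inl {Os : Finset Op} (hinv : Op.inv ∉ Os) {C : Concept}
    (hC : C.inLang Os SC SR) {j : J.Δ} {i : Fin (N + 1)} :
    (.inl (j, i) : (extend SC SR N J).Δ) ∈ C.sem (extend SC SR N J) ↔ j ∈ C.sem J := by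
  classical
  induction C generalizing j i with
  | atom A => exact Iff.rfl
  | top => exact Iff.rfl
  | bot => exact Iff.rfl
  | and C D ihC ihD => exact and_congr (ihC hC.2.1) (ihD hC.2.2)
  | or C D ihC ihD => exact or_congr (ihC hC.2.1) (ihD hC.2.2)
  | neg C ih => exact not_congr (ih hC.2)
  | ex S C ih =>
    cases S with
    | inv R => exact (hinv hC.2.1.1).elim
    | name R =>
      constructor
      · rintro ⟨_, ⟨⟨j', i'⟩, rfl, hr, rfl⟩, he⟩
        exact ⟨j', hr, (ih hC.2.2).1 he⟩
      · rintro ⟨j', hr, he⟩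
        exact ⟨.inl (j', i), ⟨_, rfl, hr, rfl⟩, (ih hC.2.2).2 he⟩
  | all S C ih =>
    cases S with
    | inv R => exact (hinv hC.2.1.1).elim
    | name R =>
      constructor
      · intro h j' hr
        exact (ih hC.2.2).1 (h (.inl (j', i)) ⟨_, rfl, hr, rfl⟩)
      · rintro h _ ⟨⟨j', i'⟩, rfl, hr, rfl⟩
        exact (ih hC.2.2).2 (h j' hr)
  | atLeast k S C ih =>
    cases S with
    | inv R => exact (hinv hC.2.2.1.1).elim
    | name R =>
      constructor
      · rintro ⟨s, rfl, hs⟩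
        have hs' : ∀ z ∈ s, ∃ j', z = .inl (j', i) ∧ J.rel R j j' ∧ j' ∈ C.sem J := by
          intro z hz
          obtain ⟨⟨⟨j', i'⟩, rfl, hr, rfl⟩, he⟩ := hs z hz
          exact ⟨j', rfl, hr, (ih hC.2.2.2).1 he⟩
        refine ⟨s.image fun z => z.elim Prod.fst fun _ => j, ?_, ?_⟩
        · refine Finset.card_image_of_injOn fun z hz w hw hzw => ?_
          obtain ⟨j₁, rfl, -⟩ := hs' z hz
          obtain ⟨j₂, rfl, -⟩ := hs' w hw
          have : j₁ = j₂ := hzw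
          rw [this]
        · intro e he
          obtain ⟨z, hz, rfl⟩ := Finset.mem_image.1 he
          obtain ⟨j', rfl, h⟩ := hs' z hz
          exact h
      · rintro ⟨s, rfl, hs⟩
        refine ⟨s.map ⟨fun j' => .inl (j', i), fun a b hab => ?_⟩, Finset.card_map _, ?_⟩
        · exact (Prod.mk.inj (Sum.inl.inj hab)).1
        · intro e he
          obtain ⟨j', hj', rfl⟩ := Finset.mem_map.1 he
          exact ⟨⟨_, rfl, (hs j' hj').1, rfl⟩, (ih hC.2.2.2).2 (hs j' hj').2⟩

theorem mem_sem_atom_lift {s : I.Δ → J.Δ} {x : I.Δ} {A : ℕ} (hA : A ∈ SC) :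
    lift SC SR N s x ∈ (Concept.atom A).sem (extend SC SR N J) ↔ x ∈ I.atom A :=
  ⟨fun ⟨_, h⟩ => h, fun h => ⟨hA, h⟩⟩

theorem rel_lift_iff {s : I.Δ → J.Δ} {x : I.Δ} {R : ℕ} (hR : R ∈ SR)
    {z : (extend SC SR N J).Δ} :
    (extend SC SR N J).rel R (lift SC SR N s x) z ↔
      ∃ q, z = .inl q ∧ ((q.2 : ℕ) : ℕ∞) < {y | I.rel R x y ∧ s y = q.1}.encard :=
  ⟨fun ⟨q, hq, _, h⟩ => ⟨q, hq, h⟩, fun ⟨q, hq, h⟩ => ⟨q, hq, hR, h⟩⟩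

theorem exists_of_rel_lift {s : I.Δ → J.Δ} {x : I.Δ} {R : ℕ} (hR : R ∈ SR)
    {z : (extend SC SR N J).Δ} (h : (extend SC SR N J).rel R (lift SC SR N s x) z) :
    ∃ y i, I.rel R x y ∧ z = .inl (s y, i) := by
  obtain ⟨⟨j, i⟩, rfl, hq⟩ := (rel_lift_iff hR).1 h
  have hpos : {y | I.rel R x y ∧ s y = j}.encard ≠ 0 := ne_bot_of_gt hq
  obtain ⟨y, hy, rfl⟩ := Set.encard_ne_zero.1 hpos
  exact ⟨y, i, hy, rfl⟩

theorem rel_lift {s : I.Δ → J.Δ} {x y : I.Δ} {R : ℕ} (hR : R ∈ SR) (h : I.rel R x y) :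
    (extend SC SR N J).rel R (lift SC SR N s x) (.inl (s y, 0)) := by
  refine (rel_lift_iff hR).2 ⟨_, rfl, ?_⟩
  have : {y' | I.rel R x y' ∧ s y' = s y}.encard ≠ 0 := Set.encard_ne_zero.2 ⟨y, h, rfl⟩
  simpa using pos_iff_ne_zero.2 this

variable {Os : Finset Op} {C : Concept} {s : I.Δ → J.Δ} {x : I.Δ} {R : ℕ}

theorem mem_sem_ex_lift (hinv : Op.inv ∉ Os) (hC : C.inLang Os SC SR) (hR : R ∈ SR) :
    lift SC SR N s x ∈ (Concept.ex (.name R) C).sem (extend SC SR N J) ↔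
      ∃ y, I.rel R x y ∧ s y ∈ C.sem J := by
  constructor
  · rintro ⟨z, hz, hzC⟩
    obtain ⟨y, i, hy, rfl⟩ := exists_of_rel_lift hR hz
    exact ⟨y, hy, (mem_sem_extend_inl hinv hC).1 hzC⟩
  · rintro ⟨y, hy, hyC⟩
    exact ⟨_, rel_lift hR hy, (mem_sem_extend_inl hinv hC).2 hyC⟩

theorem mem_sem_all_lift (hinv : Op.inv ∉ Os) (hC : C.inLang Os SC SR) (hR : R ∈ SR) :
    lift SC SR N s x ∈ (Concept.all (.name R) C).sem (extend SC SR N J) ↔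
      ∀ y, I.rel R x y → s y ∈ C.sem J := by
  constructor
  · intro h y hy
    exact (mem_sem_extend_inl hinv hC).1 (h _ (rel_lift hR hy))
  · intro h z hz
    obtain ⟨y, i, hy, rfl⟩ := exists_of_rel_lift hR hz
    exact (mem_sem_extend_inl hinv hC).2 (h y hy)

theorem exists_of_mem_sem_atLeast_lift (hinv : Op.inv ∉ Os) (hC : C.inLang Os SC SR)
    (hR : R ∈ SR) {k : ℕ}
    (h : lift SC SR N s x ∈ (Concept.atLeast k (.name R) C).sem (extend SC SR N J)) :
    ∃ S : Finset I.Δ, S.card = k ∧ ∀ y ∈ S, I.rel R x y ∧ s y ∈ C.sem J := by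
  classical
  obtain ⟨S, rfl, hS⟩ := h
  have hS' : ∀ z ∈ S, ∃ q : J.Δ × Fin (N + 1), z = .inl q ∧ q.1 ∈ C.sem J ∧
      ((q.2 : ℕ) : ℕ∞) < {y | I.rel R x y ∧ s y = q.1}.encard := by
    intro z hz
    obtain ⟨hr, hzC⟩ := hS z hz
    obtain ⟨q, rfl, hq⟩ := (rel_lift_iff hR).1 hr
    exact ⟨q, rfl, (mem_sem_extend_inl hinv hC).1 hzC, hq⟩
  have := J.dom_nonempty
  choose! q hq hqC hqlt using hS'
  have hcard : ∀ j, ((S.filter ((fun z => (q z).1) · = j)).card : ℕ∞) ≤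
      {y | y ∈ {y | I.rel R x y} ∧ s y = j}.encard := by
    intro j
    refine le_trans ?_ (encard_fin_lt_le (N + 1) _)
    rw [← Set.encard_coe_eq_coe_finsetCard]
    refine Set.encard_le_encard_of_injOn (f := fun z => (q z).2) ?_ ?_
    · intro z hz
      simp only [Finset.coe_filter, Set.mem_ofPred_eq] at hz
      obtain ⟨hz, rfl⟩ := hz
      exact hqlt z hz
    · intro z hz w hw hzw
      simp only [Finset.coe_filter, Set.mem_ofPred_eq] at hz hw
      rw [hq z hz.1, hq w hw.1, Prod.ext (hz.2.trans hw.2.symm) hzw]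
  obtain ⟨S', hS'card, hS'⟩ := exists_finset_of_card_fiber_le S _ _ _ hcard
  refine ⟨S', hS'card, fun y hy => ⟨(hS' y hy).1, ?_⟩⟩
  obtain ⟨z, hz, he⟩ := (hS' y hy).2
  rw [he]
  exact hqC z hz

theorem mem_sem_atLeast_lift (hinv : Op.inv ∉ Os) (hC : C.inLang Os SC SR)
    (hR : R ∈ SR) {k : ℕ} (hk : k ≤ N + 1)
    (h : ∃ S : Finset I.Δ, S.card = k ∧ ∀ y ∈ S, I.rel R x y ∧ s y ∈ C.sem J) :
    lift SC SR N s x ∈ (Concept.atLeast k (.name R) C).sem (extend SC SR N J) := by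
  classical
  obtain ⟨S, rfl, hS⟩ := h
  have hcard : ∀ j, ((S.filter (s · = j)).card : ℕ∞) ≤
      {q | q ∈ {q : J.Δ × Fin (N + 1) |
        ((q.2 : ℕ) : ℕ∞) < {y | I.rel R x y ∧ s y = q.1}.encard} ∧ q.1 = j}.encard := by
    intro j
    have h₁ : ((S.filter (s · = j)).card : ℕ∞) ≤ {y | I.rel R x y ∧ s y = j}.encard := by
      rw [← Set.encard_coe_eq_coe_finsetCard]
      refine Set.encard_le_encard fun y hy => ?_
      simp only [Finset.coe_filter, Set.mem_ofPred_eq] at hy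
      exact ⟨(hS y hy.1).1, hy.2⟩
    have h₂ := le_encard_fin_lt ((Finset.card_filter_le S (s · = j)).trans hk) h₁
    refine h₂.trans (Set.encard_le_encard_of_injOn (f := fun i => (j, i)) ?_ ?_)
    · exact fun i hi => ⟨hi, rfl⟩
    · exact fun i _ i' _ hii => (Prod.mk.inj hii).2
  obtain ⟨S', hS'card, hS'⟩ := exists_finset_of_card_fiber_le S s _ Prod.fst hcard
  refine ⟨S'.map ⟨Sum.inl, Sum.inl_injective⟩, (Finset.card_map _).trans hS'card, ?_⟩
  intro z hz
  obtain ⟨⟨j, i⟩, hq, rfl⟩ := Finset.mem_map.1 hz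
  obtain ⟨hlt, y, hy, he⟩ := hS' _ hq
  have he' : j = s y := he
  refine ⟨(rel_lift_iff hR).2 ⟨_, rfl, hlt⟩, (mem_sem_extend_inl hinv hC).2 ?_⟩
  rw [he']
  exact (hS y hy).2

theorem lift_preserves (hinv : Op.inv ∉ Os) (hneg : Op.neg ∉ Os) {d : ℕ∞}
    (hs : ∀ D : Concept, D.inLang Os SC SR → D.nr ≤ N + 1 → (D.dp : ℕ∞) < d →
      ∀ y, y ∈ D.sem I → s y ∈ D.sem J)
    (hC : C.inLang Os SC SR) (hnr : C.nr ≤ N + 1) (hdp : (C.dp : ℕ∞) < d + 1)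
    (hx : x ∈ C.sem I) : lift SC SR N s x ∈ C.sem (extend SC SR N J) := by
  have hpred : ∀ {n : ℕ}, ((n + 1 : ℕ) : ℕ∞) < d + 1 → (n : ℕ∞) < d := by
    intro n hn
    push_cast at hn
    exact lt_of_add_lt_add_right hn
  induction C with
  | atom A => exact (mem_sem_atom_lift hC).2 hx
  | top => trivial
  | bot => exact hx.elim
  | and C D ihC ihD =>
    refine ⟨ihC hC.2.1 ((le_max_left _ _).trans hnr) (lt_of_le_of_lt ?_ hdp) hx.1,
      ihD hC.2.2 ((le_max_right _ _).trans hnr) (lt_of_le_of_lt ?_ hdp) hx.2⟩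
    · exact_mod_cast le_max_left _ _
    · exact_mod_cast le_max_right _ _
  | or C D ihC ihD =>
    refine hx.imp (ihC hC.2.1 ((le_max_left _ _).trans hnr) (lt_of_le_of_lt ?_ hdp))
      (ihD hC.2.2 ((le_max_right _ _).trans hnr) (lt_of_le_of_lt ?_ hdp))
    · exact_mod_cast le_max_left _ _
    · exact_mod_cast le_max_right _ _
  | neg C ih => exact (hneg hC.1).elim
  | ex S C ih =>
    cases S with
    | inv R => exact (hinv hC.2.1.1).elim
    | name R =>
      obtain ⟨y, hy, hyC⟩ := hx
      exact (mem_sem_ex_lift hinv hC.2.2 hC.2.1).2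
        ⟨y, hy, hs C hC.2.2 hnr (hpred hdp) y hyC⟩
  | all S C ih =>
    cases S with
    | inv R => exact (hinv hC.2.1.1).elim
    | name R =>
      exact (mem_sem_all_lift hinv hC.2.2 hC.2.1).2
        fun y hy => hs C hC.2.2 hnr (hpred hdp) y (hx y hy)
  | atLeast k S C ih =>
    cases S with
    | inv R => exact (hinv hC.2.2.1.1).elim
    | name R =>
      obtain ⟨S, hSk, hS⟩ := hx
      exact mem_sem_atLeast_lift hinv hC.2.2.2 hC.2.2.1 ((le_max_left _ _).trans hnr)
        ⟨S, hSk, fun y hy => ⟨(hS y hy).1,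
          hs C hC.2.2.2 ((le_max_right _ _).trans hnr) (hpred hdp) y (hS y hy).2⟩⟩

theorem lift_reflects (hinv : Op.inv ∉ Os) (hneg : Op.neg ∉ Os) {d : ℕ∞}
    (hs : ∀ D : Concept, D.inLang Os SC SR → (D.dp : ℕ∞) < d →
      ∀ y, s y ∈ D.sem J → y ∈ D.sem I)
    (hC : C.inLang Os SC SR) (hdp : (C.dp : ℕ∞) < d + 1)
    (hx : lift SC SR N s x ∈ C.sem (extend SC SR N J)) : x ∈ C.sem I := by
  have hpred : ∀ {n : ℕ}, ((n + 1 : ℕ) : ℕ∞) < d + 1 → (n : ℕ∞) < d := by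
    intro n hn
    push_cast at hn
    exact lt_of_add_lt_add_right hn
  induction C with
  | atom A => exact (mem_sem_atom_lift hC).1 hx
  | top => trivial
  | bot => exact hx.elim
  | and C D ihC ihD =>
    refine ⟨ihC hC.2.1 (lt_of_le_of_lt ?_ hdp) hx.1, ihD hC.2.2 (lt_of_le_of_lt ?_ hdp) hx.2⟩
    · exact_mod_cast le_max_left _ _
    · exact_mod_cast le_max_right _ _
  | or C D ihC ihD =>
    refine hx.imp (ihC hC.2.1 (lt_of_le_of_lt ?_ hdp)) (ihD hC.2.2 (lt_of_le_of_lt ?_ hdp))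
    · exact_mod_cast le_max_left _ _
    · exact_mod_cast le_max_right _ _
  | neg C ih => exact (hneg hC.1).elim
  | ex S C ih =>
    cases S with
    | inv R => exact (hinv hC.2.1.1).elim
    | name R =>
      obtain ⟨y, hy, hyC⟩ := (mem_sem_ex_lift hinv hC.2.2 hC.2.1).1 hx
      exact ⟨y, hy, hs C hC.2.2 (hpred hdp) y hyC⟩
  | all S C ih =>
    cases S with
    | inv R => exact (hinv hC.2.1.1).elim
    | name R =>
      exact fun y hy => hs C hC.2.2 (hpred hdp) y
        ((mem_sem_all_lift hinv hC.2.2 hC.2.1).1 hx y hy)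
  | atLeast k S C ih =>
    cases S with
    | inv R => exact (hinv hC.2.2.1.1).elim
    | name R =>
      obtain ⟨S, hSk, hS⟩ := exists_of_mem_sem_atLeast_lift hinv hC.2.2.2 hC.2.2.1 hx
      exact ⟨S, hSk, fun y hy => ⟨(hS y hy).1, hs C hC.2.2.2 (hpred hdp) y (hS y hy).2⟩⟩

/-- Iteration of `extend`, starting from `B`. -/
def levels (SC SR : Finset ℕ) (N : ℕ) (B : Interp) : ℕ → Interp
  | 0 => B
  | k + 1 => extend SC SR N (levels SC SR N B k)

theorem finite_levels {B : Interp} (hB : Finite B.Δ) (k : ℕ) :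
    Finite (levels SC SR N B k).Δ := by
  induction k with
  | zero => exact hB
  | succ k ih =>
    exact inferInstanceAs (Finite (((levels SC SR N B k).Δ × Fin (N + 1)) ⊕
      (Set SC × (SR → Set ((levels SC SR N B k).Δ × Fin (N + 1))))))

/-- The point of `levels SC SR N B k` that imitates `x` up to depth `k`. -/
noncomputable def unravel (SC SR : Finset ℕ) (N : ℕ) {B : Interp} (b : I.Δ → B.Δ) :
    (k : ℕ) → I.Δ → (levels SC SR N B k).Δ
  | 0 => b
  | k + 1 => lift SC SR N (unravel SC SR N b k)

theorem unravel_preserves {B : Interp} {b : I.Δ → B.Δ} (hinv : Op.inv ∉ Os) (hneg : Op.neg ∉ Os)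
    {d : ℕ∞}
    (hb : ∀ D : Concept, D.inLang Os SC SR → D.nr ≤ N + 1 → (D.dp : ℕ∞) < d →
      ∀ y, y ∈ D.sem I → b y ∈ D.sem B) (k : ℕ) :
    ∀ D : Concept, D.inLang Os SC SR → D.nr ≤ N + 1 → (D.dp : ℕ∞) < d + k →
      ∀ y, y ∈ D.sem I → unravel SC SR N b k y ∈ D.sem (levels SC SR N B k) := by
  induction k with
  | zero => simpa using! hb
  | succ k ih =>
    intro D hD hnr hdp y hy
    refine lift_preserves hinv hneg ih hD hnr ?_ hy
    rw [add_assoc]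
    exact_mod_cast hdp

theorem unravel_reflects {B : Interp} {b : I.Δ → B.Δ} (hinv : Op.inv ∉ Os) (hneg : Op.neg ∉ Os)
    {d : ℕ∞}
    (hb : ∀ D : Concept, D.inLang Os SC SR → (D.dp : ℕ∞) < d →
      ∀ y, b y ∈ D.sem B → y ∈ D.sem I) (k : ℕ) :
    ∀ D : Concept, D.inLang Os SC SR → (D.dp : ℕ∞) < d + k →
      ∀ y, unravel SC SR N b k y ∈ D.sem (levels SC SR N B k) → y ∈ D.sem I := by
  induction k with
  | zero => simpa using! hb
  | succ k ih =>
    intro D hD hdp y hy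
    refine lift_reflects hinv hneg ih hD ?_ hy
    rw [add_assoc]
    exact_mod_cast hdp

end Extend

/-! ### Languages with value restrictions -/

/-- The operators other than inverse roles, `⊥` and negation. -/
abbrev posAllOps : Finset Op := {Op.all, Op.ex, Op.ge, Op.and, Op.or, Op.top}

/-- `N + 1` points, all of them related by every role and satisfying every concept name. -/
def cliqueInterp (N : ℕ) : Interp where
  Δ := Fin (N + 1)
  dom_nonempty := ⟨0⟩
  atom _ := Set.univ
  rel _ _ _ := True

theorem mem_sem_cliqueInterp {N : ℕ} {SC SR : Finset ℕ} {C : Concept}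
    (hC : C.inLang posAllOps SC SR) (hnr : C.nr ≤ N + 1) (x : (cliqueInterp N).Δ) :
    x ∈ C.sem (cliqueInterp N) := by
  induction C generalizing x with
  | atom A => trivial
  | top => trivial
  | bot => simp [Concept.inLang] at hC
  | and C D ihC ihD =>
    exact ⟨ihC hC.2.1 ((le_max_left _ _).trans hnr) x,
      ihD hC.2.2 ((le_max_right _ _).trans hnr) x⟩
  | or C D ihC ihD => exact Or.inl (ihC hC.2.1 ((le_max_left _ _).trans hnr) x)
  | neg C ih => simp [Concept.inLang] at hC
  | ex S C ih => exact ⟨x, by cases S <;> trivial, ih hC.2.2 hnr x⟩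
  | all S C ih => exact fun y _ => ih hC.2.2 hnr y
  | atLeast k S C ih =>
    obtain ⟨s, hs⟩ : ∃ s : Finset (Fin (N + 1)), s.card = k := by
      obtain ⟨s, -, hs⟩ := Finset.exists_subset_card_eq (s := (Finset.univ : Finset (Fin (N + 1))))
        (n := k) (by simpa using (le_max_left _ _).trans hnr)
      exact ⟨s, hs⟩
    exact ⟨s, hs, fun y _ => ⟨by cases S <;> trivial,
      ih hC.2.2.2 ((le_max_right _ _).trans hnr) y⟩⟩

theorem nr_le_of_mem_sem_cliqueInterp {N : ℕ} {Os : Finset Op} (hneg : Op.neg ∉ Os)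
    (hor : Op.or ∉ Os) {SC SR : Finset ℕ} {C : Concept}
    (hC : C.inLang Os SC SR) {x : (cliqueInterp N).Δ} (hx : x ∈ C.sem (cliqueInterp N)) :
    C.nr ≤ N + 1 := by
  induction C generalizing x with
  | atom A => exact Nat.zero_le _
  | top => exact Nat.zero_le _
  | bot => exact Nat.zero_le _
  | and C D ihC ihD => exact max_le (ihC hC.2.1 hx.1) (ihD hC.2.2 hx.2)
  | or C D ihC ihD => exact (hor hC.1).elim
  | neg C ih => exact (hneg hC.1).elim
  | ex S C ih =>
    obtain ⟨y, -, hy⟩ := hx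
    exact ih hC.2.2 hy
  | all S C ih => exact ih hC.2.2 (hx x (by cases S <;> trivial))
  | atLeast k S C ih =>
    obtain ⟨s, rfl, hs⟩ := hx
    obtain ⟨y, hy⟩ := Finset.card_pos.1 hC.2.1
    refine max_le ?_ (ih hC.2.2.2 (hs y hy).2)
    exact (Finset.card_le_univ (α := Fin (N + 1)) s).trans_eq (by simp)

/-- Finitely many negative examples force every fitting concept with number restrictions bounded
by `N + 1` to be subsumed by `C`. -/
theorem exists_negative_examples {SC SR : Finset ℕ} {N : ℕ} {C : Concept}
    (hC : C.inLang posAllOps SC SR) :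
    ∃ L : List PInterp, (∀ e ∈ L, e.finite ∧ e.pt ∉ C.sem e.I) ∧
      ∀ D : Concept, D.inLang posAllOps SC SR → D.nr ≤ N + 1 →
        (∀ e ∈ L, e.pt ∉ D.sem e.I) → Subsumes D C := by
  let U := levels SC SR N (cliqueInterp N) (C.dp + 1)
  have hU : Finite U.Δ := finite_levels (inferInstanceAs (Finite (Fin (N + 1)))) _
  obtain ⟨L, hL, hL'⟩ := exists_list_pointed U (C.sem U)ᶜ
  refine ⟨L, fun e he => ?_, fun D hD hnr hfit I x hx => ?_⟩
  · obtain ⟨y, hy, rfl⟩ := hL e he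
    exact ⟨hU, hy⟩
  · by_contra hxC
    let b : I.Δ → (cliqueInterp N).Δ := fun _ => (0 : Fin (N + 1))
    refine hfit _ (hL' (unravel SC SR N b (C.dp + 1) x) fun h => hxC ?_) ?_
    · refine unravel_reflects (d := 0) (by decide) (by decide) (fun _ _ h => ?_) _ C hC ?_ x h
      · exact absurd h not_lt_zero
      · rw [zero_add]
        exact_mod_cast Nat.lt_succ_self _
    · refine unravel_preserves (d := ⊤) (by decide) (by decide)
        (fun E hE hEnr _ y _ => mem_sem_cliqueInterp hE hEnr _) _ D hD hnr ?_ x hx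
      rw [top_add]
      exact ENat.natCast_lt_top _

theorem nr_eq_zero {Os : Finset Op} (hge : Op.ge ∉ Os) {SC SR : Finset ℕ} {C : Concept}
    (hC : C.inLang Os SC SR) : C.nr = 0 := by
  induction C with
  | atom A => rfl
  | top => rfl
  | bot => rfl
  | and C D ihC ihD => simp [Concept.nr, ihC hC.2.1, ihD hC.2.2]
  | or C D ihC ihD => simp [Concept.nr, ihC hC.2.1, ihD hC.2.2]
  | neg C ih => exact ih hC.2
  | ex S C ih => exact ih hC.2.2
  | all S C ih => exact ih hC.2.2
  | atLeast k S C ih => exact (hge hC.1).elim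

/-- A reflexive point satisfying no concept name. -/
def emptyLoopInterp : Interp where
  Δ := Unit
  dom_nonempty := ⟨()⟩
  atom _ := ∅
  rel _ _ _ := True

theorem notMem_sem_emptyLoopInterp {SC SR : Finset ℕ} {C : Concept}
    (hC : C.inLang {Op.all, Op.ex, Op.or, Op.and} SC SR) (x : emptyLoopInterp.Δ) :
    x ∉ C.sem emptyLoopInterp := by
  induction C generalizing x with
  | atom A => exact fun h => h
  | top => simp [Concept.inLang] at hC
  | bot => exact fun h => h
  | and C D ihC ihD => exact fun h => ihC hC.2.1 x h.1
  | or C D ihC ihD => exact fun h => h.elim (ihC hC.2.1 x) (ihD hC.2.2 x)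
  | neg C ih => simp [Concept.inLang] at hC
  | ex S C ih =>
    rintro ⟨y, -, hy⟩
    exact ih hC.2.2 y hy
  | all S C ih => exact fun h => ih hC.2.2 x (h x (by cases S <;> trivial))
  | atLeast k S C ih => simp [Concept.inLang] at hC

theorem admitsFinChar_all_ex_or_and : AdmitsFinChar {Op.all, Op.ex, Op.or, Op.and} := by
  intro SC SR C hC
  have hsub : ({Op.all, Op.ex, Op.or, Op.and} : Finset Op) ⊆ posAllOps := by decide
  have hnr : ∀ {D : Concept}, D.inLang {Op.all, Op.ex, Op.or, Op.and} SC SR → D.nr ≤ 0 + 1 :=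
    fun hD => (nr_eq_zero (by decide) hD).trans_le (Nat.zero_le _)
  obtain ⟨Neg, hNeg, hNeg'⟩ := exists_negative_examples (N := 0) (Concept.inLang_mono hsub hC)
  let U := levels SC SR 0 emptyLoopInterp (C.dp + 1)
  have hU : Finite U.Δ := finite_levels (inferInstanceAs (Finite Unit)) _
  obtain ⟨Pos, hPos, hPos'⟩ := exists_list_pointed U (C.sem U)
  refine ⟨Pos, Neg, finChar_of_subsumes (fun e he => ?_) hNeg fun D hD hfit =>
    ⟨fun I x hx => ?_, hNeg' D (Concept.inLang_mono hsub hD) (hnr hD) hfit.2⟩⟩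
  · obtain ⟨y, hy, rfl⟩ := hPos e he
    exact ⟨hU, hy⟩
  · let b : I.Δ → emptyLoopInterp.Δ := fun _ => ()
    refine unravel_reflects (d := ⊤) (by decide) (by decide)
      (fun E hE _ y hy => (notMem_sem_emptyLoopInterp hE _ hy).elim) _ D hD ?_ x
      (hfit.1 _ (hPos' (unravel SC SR 0 b (C.dp + 1) x) ?_))
    · rw [top_add]
      exact ENat.natCast_lt_top _
    · refine unravel_preserves (d := 0) (by decide) (by decide) (fun _ _ _ h => ?_) _ C hC (hnr hC)
        ?_ x hx
      · exact absurd h not_lt_zero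
      · rw [zero_add]
        exact_mod_cast Nat.lt_succ_self _

/-- The operators of the language with value and number restrictions. -/
abbrev numOps : Finset Op := {Op.all, Op.ex, Op.ge, Op.and, Op.top}

/-- Two points without concept names, of which `true` sees both and `false` sees none. -/
def forkInterp : Interp where
  Δ := Bool
  dom_nonempty := ⟨true⟩
  atom _ := ∅
  rel _ p _ := p = true

theorem mem_sem_of_forkInterp {SC SR : Finset ℕ} {C : Concept} (hC : C.inLang numOps SC SR)
    (h : ∀ p : forkInterp.Δ, p ∈ C.sem forkInterp) (I : Interp) (x : I.Δ) : x ∈ C.sem I := by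
  induction C generalizing x with
  | atom A => exact (h true).elim
  | top => trivial
  | bot => exact (h true).elim
  | and C D ihC ihD => exact ⟨ihC hC.2.1 (fun p => (h p).1) x, ihD hC.2.2 (fun p => (h p).2) x⟩
  | or C D ihC ihD => simp [Concept.inLang] at hC
  | neg C ih => simp [Concept.inLang] at hC
  | ex S C ih =>
    cases S with
    | inv R => simp [Concept.inLang, Role.inSig] at hC
    | name R =>
      obtain ⟨_, hr, -⟩ := h false
      exact (Bool.false_ne_true hr).elim
  | all S C ih =>
    cases S with
    | inv R => simp [Concept.inLang, Role.inSig] at hC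
    | name R => exact fun y _ => ih hC.2.2 (fun p => h true p rfl) y
  | atLeast k S C ih =>
    cases S with
    | inv R => simp [Concept.inLang, Role.inSig] at hC
    | name R =>
      obtain ⟨s, rfl, hs⟩ := h false
      obtain ⟨y, hy⟩ := Finset.card_pos.1 hC.2.1
      exact (Bool.false_ne_true (hs y hy).1).elim

/-- Without disjunction, falsity of a single concept `D` at `x` can be transferred to a point of
`levels SC SR N forkInterp k` that satisfies all concepts of depth below `k` satisfied at `x`. -/
theorem exists_level_point {SC SR : Finset ℕ} {N : ℕ} {I : Interp} (k : ℕ) {D : Concept}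
    (hD : D.inLang numOps SC SR) (x : I.Δ) :
    ∃ t : (levels SC SR N forkInterp k).Δ,
      (t ∈ D.sem (levels SC SR N forkInterp k) → x ∈ D.sem I) ∧
      ∀ C : Concept, C.inLang numOps SC SR → C.nr ≤ N + 1 → (C.dp : ℕ∞) < k → x ∈ C.sem I →
        t ∈ C.sem (levels SC SR N forkInterp k) := by
  induction k generalizing D x with
  | zero =>
    by_cases h : ∀ p : forkInterp.Δ, p ∈ D.sem forkInterp
    · exact ⟨true, fun _ => mem_sem_of_forkInterp hD h I x, fun _ _ _ h => absurd h not_lt_zero⟩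
    · push Not at h
      obtain ⟨p, hp⟩ := h
      exact ⟨p, fun h => absurd h hp, fun _ _ _ h => absurd h not_lt_zero⟩
  | succ k ih =>
    have hlift : ∀ {E : Concept}, E.inLang numOps SC SR →
        ∃ s : I.Δ → (levels SC SR N forkInterp k).Δ,
          (∀ y, s y ∈ E.sem (levels SC SR N forkInterp k) → y ∈ E.sem I) ∧
          ∀ C : Concept, C.inLang numOps SC SR → C.nr ≤ N + 1 → (C.dp : ℕ∞) < (k + 1 : ℕ) →
            x ∈ C.sem I → lift SC SR N s x ∈ C.sem (levels SC SR N forkInterp (k + 1)) := by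
      intro E hE
      choose s hs hs' using fun y => ih hE y
      refine ⟨s, hs, fun C hC hnr hdp => ?_⟩
      exact lift_preserves (by decide) (by decide) (d := k)
        (fun F hF hFnr hFdp y => hs' y F hF hFnr hFdp) hC hnr (by exact_mod_cast hdp)
    induction D with
    | atom A =>
      obtain ⟨s, -, hs⟩ := hlift hD
      exact ⟨_, (mem_sem_atom_lift hD).1, hs⟩
    | top =>
      obtain ⟨s, -, hs⟩ := hlift hD
      exact ⟨_, fun _ => trivial, hs⟩
    | bot => simp [Concept.inLang] at hD
    | and D E ihD ihE =>
      by_cases hx : x ∈ D.sem I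
      · obtain ⟨t, ht, ht'⟩ := ihE hD.2.2
        exact ⟨t, fun h => ⟨hx, ht h.2⟩, ht'⟩
      · obtain ⟨t, ht, ht'⟩ := ihD hD.2.1
        exact ⟨t, fun h => (hx (ht h.1)).elim, ht'⟩
    | or D E ihD ihE => simp [Concept.inLang] at hD
    | neg D ih => simp [Concept.inLang] at hD
    | ex S E _ =>
      cases S with
      | inv R => simp [Concept.inLang, Role.inSig] at hD
      | name R =>
        obtain ⟨s, hs, hs'⟩ := hlift hD.2.2
        refine ⟨_, fun h => ?_, hs'⟩
        obtain ⟨y, hy, hyE⟩ := (mem_sem_ex_lift (by decide) hD.2.2 hD.2.1).1 h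
        exact ⟨y, hy, hs y hyE⟩
    | all S E _ =>
      cases S with
      | inv R => simp [Concept.inLang, Role.inSig] at hD
      | name R =>
        obtain ⟨s, hs, hs'⟩ := hlift hD.2.2
        refine ⟨_, fun h => ?_, hs'⟩
        exact fun y hy => hs y ((mem_sem_all_lift (by decide) hD.2.2 hD.2.1).1 h y hy)
    | atLeast m S E _ =>
      cases S with
      | inv R => simp [Concept.inLang, Role.inSig] at hD
      | name R =>
        obtain ⟨s, hs, hs'⟩ := hlift hD.2.2.2
        refine ⟨_, fun h => ?_, hs'⟩
        obtain ⟨Y, hYm, hY⟩ := exists_of_mem_sem_atLeast_lift (by decide) hD.2.2.2 hD.2.2.1 h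
        exact ⟨Y, hYm, fun y hy => ⟨(hY y hy).1, hs y (hY y hy).2⟩⟩

theorem admitsFinChar_numOps : AdmitsFinChar numOps := by
  intro SC SR C hC
  have hsub : numOps ⊆ posAllOps := by decide
  obtain ⟨Neg, hNeg, hNeg'⟩ :=
    exists_negative_examples (N := C.nr) (Concept.inLang_mono hsub hC)
  let U := levels SC SR C.nr forkInterp (C.dp + 1)
  have hU : Finite U.Δ := finite_levels (inferInstanceAs (Finite Bool)) _
  obtain ⟨Pos, hPos, hPos'⟩ := exists_list_pointed U (C.sem U)
  let c : PInterp := ⟨cliqueInterp C.nr, (0 : Fin (C.nr + 1))⟩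
  refine ⟨c :: Pos, Neg, finChar_of_subsumes (fun e he => ?_) hNeg fun D hD hfit =>
    ⟨fun I x hx => ?_, hNeg' D (Concept.inLang_mono hsub hD) ?_ hfit.2⟩⟩
  · rcases List.mem_cons.1 he with rfl | he
    · exact ⟨inferInstanceAs (Finite (Fin (C.nr + 1))),
        mem_sem_cliqueInterp (Concept.inLang_mono hsub hC) (Nat.le_succ _) _⟩
    · obtain ⟨y, hy, rfl⟩ := hPos e he
      exact ⟨hU, hy⟩
  · obtain ⟨t, ht, ht'⟩ := exists_level_point (N := C.nr) (C.dp + 1) hD x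
    refine ht (hfit.1 _ (List.mem_cons_of_mem _ (hPos' t (ht' C hC (Nat.le_succ _) ?_ hx))))
    exact_mod_cast Nat.lt_succ_self _
  · exact nr_le_of_mem_sem_cliqueInterp (by decide) (by decide) hD
      (hfit.1 c List.mem_cons_self)

/-! ### The classification -/

theorem Op.forall_iff {P : Op → Prop} : (∀ o, P o) ↔
    P .all ∧ P .ex ∧ P .ge ∧ P .inv ∧ P .and ∧ P .or ∧ P .top ∧ P .bot ∧ P .neg :=
  ⟨fun h => ⟨h _, h _, h _, h _, h _, h _, h _, h _, h _⟩, fun h o => by cases o <;> tauto⟩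

/-- **Theorem 1 (classification without ontologies)**.
Let `{∃,⊓} ⊆ Os ⊆ {∀,∃,≥,−,⊓,⊔,⊤,⊥,¬}`.
(1) If `Os` is contained in `{∃,−,⊓,⊔,⊤,⊥}`, `{∀,∃,⊔,⊓}` or `{∀,∃,≥,⊓,⊤}`,
then `L(Os)` admits finite characterisations.
(2) Otherwise, unless `{≥,−,⊓} ⊆ Os ⊆ {∃,≥,−,⊓,⊤}`, `L(Os)` does not admit
finite characterisations. -/
theorem classification_without_ontology (Os : Finset Op)
    (hlo : ({Op.ex, Op.and} : Finset Op) ⊆ Os)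
    (hhi : Os ⊆ ({Op.all, Op.ex, Op.ge, Op.inv, Op.and, Op.or, Op.top, Op.bot, Op.neg} : Finset Op)) :
    ((Os ⊆ ({Op.ex, Op.inv, Op.and, Op.or, Op.top, Op.bot} : Finset Op) ∨
      Os ⊆ ({Op.all, Op.ex, Op.or, Op.and} : Finset Op) ∨
      Os ⊆ ({Op.all, Op.ex, Op.ge, Op.and, Op.top} : Finset Op)) →
        AdmitsFinChar Os) ∧
    ((¬ (Os ⊆ ({Op.ex, Op.inv, Op.and, Op.or, Op.top, Op.bot} : Finset Op) ∨
         Os ⊆ ({Op.all, Op.ex, Op.or, Op.and} : Finset Op) ∨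
         Os ⊆ ({Op.all, Op.ex, Op.ge, Op.and, Op.top} : Finset Op))) →
      ¬ (({Op.ge, Op.inv, Op.and} : Finset Op) ⊆ Os ∧
         Os ⊆ ({Op.ex, Op.ge, Op.inv, Op.and, Op.top} : Finset Op)) →
      ¬ AdmitsFinChar Os) := by
  refine ⟨?_, fun h₁ h₂ => ?_⟩
  · rintro (h | h | h)
    · exact admitsFinChar_posExOps.mono h
    · exact admitsFinChar_all_ex_or_and.mono h
    · exact admitsFinChar_numOps.mono h
  · have hfail : ({Op.ex, Op.and, Op.neg} : Finset Op) ⊆ Os ∨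
        ({Op.ex, Op.and, Op.ge, Op.or} : Finset Op) ⊆ Os ∨
        ({Op.ex, Op.and, Op.ge, Op.bot} : Finset Op) ⊆ Os ∨
        ({Op.ex, Op.and, Op.all, Op.inv} : Finset Op) ⊆ Os ∨
        ({Op.ex, Op.and, Op.all, Op.bot} : Finset Op) ⊆ Os ∨
        ({Op.ex, Op.and, Op.all, Op.or, Op.top} : Finset Op) ⊆ Os := by
      simp only [Finset.subset_iff, Op.forall_iff, Finset.mem_insert, Finset.mem_singleton] at hlo h₁ h₂ ⊢
      grind
    rcases hfail with h | h | h | h | h | h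
    · exact fun H => not_admitsFinChar_ex_and_neg (H.mono h)
    · exact fun H => not_admitsFinChar_ex_and_ge_or (H.mono h)
    · exact fun H => not_admitsFinChar_ex_and_ge_bot (H.mono h)
    · exact fun H => not_admitsFinChar_ex_and_all_inv (H.mono h)
    · exact fun H => not_admitsFinChar_ex_and_all_bot (H.mono h)
    · exact fun H => not_admitsFinChar_ex_and_all_or_top (H.mono h)

end DL
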